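/- Let d ≥ 1, K > 0, x ∈ ℍ^{d,K}, and v ∈ T_x ℍ^{d,K} with ⟨v,v⟩_M > 0. Set ‖v‖_M := √⟨v,v⟩_M and y := exp_x^K(v) := cosh(‖v‖_M/√K)·x + √K·sinh(‖v‖_M/√K)·v/‖v‖_M. Then the logarithmic map inverts the exponential map: log_x^K(y) := d_M^K(x,y)·(y + (1/K)⟨x,y⟩_M·x)/‖y + (1/K)⟨x,y⟩_M·x‖_M equals v. -/

import Mathlib

noncomputable section

/-- Minkowski inner product on `ℝ^(d+1)`: `⟨x,y⟩_M = -x₀y₀ + ∑_{i=1}^d xᵢyᵢ`. -/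
def mink {d : ℕ} (x y : Fin (d + 1) → ℝ) : ℝ :=
  -(x 0 * y 0) + ∑ i : Fin d, x i.succ * y i.succ

/-- Inverse hyperbolic cosine (on `[1, ∞)`). -/
def arcosh (x : ℝ) : ℝ := Real.log (x + Real.sqrt (x ^ 2 - 1))

/-- The Minkowski product is symmetric. -/
theorem mink_comm {d : ℕ} (x y : Fin (d + 1) → ℝ) : mink x y = mink y x := by
  simp only [mink, mul_comm]

theorem mink_add_right {d : ℕ} (x y z : Fin (d + 1) → ℝ) :
    mink x (y + z) = mink x y + mink x z := by
  simp only [mink, Pi.add_apply, mul_add, Finset.sum_add_distrib]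
  ring

theorem mink_smul_right {d : ℕ} (a : ℝ) (x y : Fin (d + 1) → ℝ) :
    mink x (a • y) = a * mink x y := by
  simp only [mink, Pi.smul_apply, smul_eq_mul, mul_add, Finset.mul_sum, mul_left_comm _ a, mul_neg]

theorem mink_smul_smul_self {d : ℕ} (a : ℝ) (x : Fin (d + 1) → ℝ) :
    mink (a • x) (a • x) = a ^ 2 * mink x x := by
  rw [mink_smul_right, mink_comm, mink_smul_right]
  ring

theorem arcosh_cosh {t : ℝ} (ht : 0 ≤ t) : arcosh (Real.cosh t) = t :=
  Real.arcosh_cosh ht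

theorem stmt12 (d : ℕ) (hd : 1 ≤ d) (K : ℝ) (hK : 0 < K)
    (x : Fin (d + 1) → ℝ) (hx : mink x x = -K) (hx0 : 0 < x 0)
    (v : Fin (d + 1) → ℝ) (hvx : mink v x = 0) (hvv : 0 < mink v v)
    (n : ℝ) (hn : n = Real.sqrt (mink v v))
    (y : Fin (d + 1) → ℝ)
    (hy : y = Real.cosh (n / Real.sqrt K) • x +
      (Real.sqrt K * Real.sinh (n / Real.sqrt K) / n) • v)
    (u : Fin (d + 1) → ℝ) (hu : u = y + ((1 / K) * mink x y) • x) :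
    (Real.sqrt K * arcosh (-mink x y / K) / Real.sqrt (mink u u)) • u = v := by
  have hn0 : 0 < n := hn ▸ Real.sqrt_pos.mpr hvv
  have hsK : 0 < Real.sqrt K := Real.sqrt_pos.mpr hK
  have ht : 0 < n / Real.sqrt K := div_pos hn0 hsK
  have hsinh : 0 < Real.sinh (n / Real.sqrt K) := Real.sinh_pos_iff.mpr ht
  have hxy : mink x y = -K * Real.cosh (n / Real.sqrt K) := by
    rw [hy, mink_add_right, mink_smul_right, mink_smul_right, hx, mink_comm x v, hvx]
    ring
  have huv : u = (Real.sqrt K * Real.sinh (n / Real.sqrt K) / n) • v := by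
    have hcoeff : 1 / K * (-K * Real.cosh (n / Real.sqrt K)) = -Real.cosh (n / Real.sqrt K) := by
      field_simp
    rw [hu, hxy, hcoeff, hy, neg_smul]
    abel
  have hnorm : Real.sqrt (mink u u) = Real.sqrt K * Real.sinh (n / Real.sqrt K) := by
    rw [huv, mink_smul_smul_self, Real.sqrt_mul (sq_nonneg _), Real.sqrt_sq (by positivity), ← hn]
    field_simp
  have hdist : arcosh (-mink x y / K) = n / Real.sqrt K := by
    rw [hxy, show -(-K * Real.cosh (n / Real.sqrt K)) / K = Real.cosh (n / Real.sqrt K) by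
      field_simp, arcosh_cosh ht.le]
  rw [hnorm, hdist, huv, smul_smul, mul_div_cancel₀ n hsK.ne',
    div_mul_div_cancel₀ (mul_pos hsK hsinh).ne', div_self hn0.ne', one_smul]
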